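/- If F is a distribution function with F(1) = 0 and F ∈ D(φ) ∪ D(Λ), and G(x) = F(e^x) with upper endpoint y₀ = sup{x : G(x) < 1}, then for every λ > 0, (G⁻¹(1 − λu) − G⁻¹(1 − u)) / R_1(G⁻¹(1 − u), y₀, G) → −log λ as u → 0+. -/

import Mathlib

open MeasureTheory Filter Topology Set

noncomputable section

/-- A distribution function: nondecreasing, right-continuous, with limits 0 at -∞ and 1 at +∞. -/
def IsDF (F : ℝ → ℝ) : Prop :=
  Monotone F ∧ (∀ x, ContinuousWithinAt F (Set.Ici x) x) ∧
    Tendsto F atBot (𝓝 0) ∧ Tendsto F atTop (𝓝 1)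

/-- `F` lies in the domain of attraction of `M`. -/
def MemDomAttr (F M : ℝ → ℝ) : Prop :=
  ∃ a b : ℕ → ℝ, (∀ n, 0 < a n) ∧
    ∀ x, ContinuousAt M x →
      Tendsto (fun n => F (a n * x + b n) ^ n) atTop (𝓝 (M x))

/-- The Gumbel distribution function Λ. -/
def gumbelDF (x : ℝ) : ℝ := Real.exp (-Real.exp (-x))

/-- The Fréchet distribution function φ_γ. -/
def frechetDF (γ : ℝ) (x : ℝ) : ℝ := if 0 < x then Real.exp (-(x ^ (-γ))) else 0

/-- The Weibull distribution function ψ_γ. -/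
def weibullDF (γ : ℝ) (x : ℝ) : ℝ := if x < 0 then Real.exp (-((-x) ^ γ)) else 1

/-- Generalized inverse `F⁻¹(u) = inf {x | F x ≥ u}`. -/
def genInv (F : ℝ → ℝ) (u : ℝ) : ℝ := sInf {x | u ≤ F x}

/-- Upper endpoint `x₀(F) = sup {x | F x < 1}`. -/
def upEnd (F : ℝ → ℝ) : ℝ := sSup {x | F x < 1}

/-- Membership in `D(φ) = ⋃_{γ>0} D(φ_γ)`. -/
def MemFrechetDom (F : ℝ → ℝ) : Prop := ∃ γ, 0 < γ ∧ MemDomAttr F (frechetDF γ)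

/-- Membership in `D(ψ) = ⋃_{γ>0} D(ψ_γ)`. -/
def MemWeibullDom (F : ℝ → ℝ) : Prop := ∃ γ, 0 < γ ∧ MemDomAttr F (weibullDF γ)

/-- Membership in `Γ = D(Λ) ∪ D(φ) ∪ D(ψ)`. -/
def MemGamma (F : ℝ → ℝ) : Prop :=
  MemDomAttr F gumbelDF ∨ MemFrechetDom F ∨ MemWeibullDom F

/-- Iterated integral `x ↦ ∫_x^z dy_1 ∫_{y_1}^z ⋯ ∫_{y_p}^z (1 - H t) dt`. -/
def iterInt (H : ℝ → ℝ) (z : ℝ) : ℕ → ℝ → ℝ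
  | 0 => fun x => ∫ t in x..z, (1 - H t)
  | (p + 1) => fun x => ∫ y in x..z, iterInt H z p y

/-- `Rp p x z H` is `R_p(x, z, H)` (for `p ≥ 1`). -/
def Rp (p : ℕ) (x z : ℝ) (H : ℝ → ℝ) : ℝ := (1 - H x)⁻¹ * iterInt H z (p - 1) x

/-- Iterated integral with upper endpoint `x₀(H)` (handled as an integral up to +∞,
since `1 - H` vanishes beyond the upper endpoint). -/
def iterIntInf (H : ℝ → ℝ) : ℕ → ℝ → ℝ
  | 0 => fun x => ∫ t in Set.Ioi x, (1 - H t)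
  | (p + 1) => fun x => ∫ y in Set.Ioi x, iterIntInf H p y

/-- `RpInf p x H` is `R_p(x, H) = R_p(x, x₀(H), H)` (for `p ≥ 1`). -/
def RpInf (p : ℕ) (x : ℝ) (H : ℝ → ℝ) : ℝ := (1 - H x)⁻¹ * iterIntInf H (p - 1) x

/-- Regular variation at zero with exponent `d`. -/
def RegVarAtZero (s : ℝ → ℝ) (d : ℝ) : Prop :=
  ∀ l : ℝ, 0 < l → Tendsto (fun u => s (l * u) / s u) (𝓝[>] (0 : ℝ)) (𝓝 (l ^ d))

/-- `orderStat n j v`: the `j`-th smallest (1-indexed) among `v 0, …, v (n-1)`. -/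
def orderStat (n j : ℕ) (v : ℕ → ℝ) : ℝ :=
  ((Multiset.map v (Multiset.range n)).sort (· ≤ ·)).getD (j - 1) 0

/-- Cumulative distribution function of the centered Gaussian law with variance `v`. -/
def gaussCdf (v : ℝ) (x : ℝ) : ℝ :=
  ((ProbabilityTheory.gaussianReal 0 v.toNNReal) (Set.Iic x)).toReal


open Classical in
/-- The filter "x → x₀(G)⁻" of approach to the upper endpoint from below
(`atTop` when the upper endpoint is infinite). -/
def upEndFilter (G : ℝ → ℝ) : Filter ℝ :=
  if BddAbove {x | G x < 1} then 𝓝[<] (upEnd G) else atTop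


lemma aux_galois (F : ℝ → ℝ) (hF : IsDF F) (hF1 : F 1 = 0) (s : ℝ) (hs : 0 < s) (hs1 : s < 1)
    (x : ℝ) : genInv F (1 - s) ≤ x ↔ 1 - s ≤ F x := by
  obtain ⟨hm, hc, -, ht⟩ := hF
  have hbdd : BddBelow {x | 1 - s ≤ F x} := by
    refine ⟨1, fun y hy => ?_⟩
    by_contra h
    have := hm (le_of_not_ge h)
    simp only [mem_ofPred_eq] at hy
    linarith
  have hne : {x | 1 - s ≤ F x}.Nonempty := by
    have := (ht.eventually (lt_mem_nhds (show 1 - s < 1 by linarith))).exists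
    obtain ⟨y, hy⟩ := this
    exact ⟨y, hy.le⟩
  constructor
  · intro h
    have h1 : ∀ y, x < y → 1 - s ≤ F y := by
      intro y hy
      obtain ⟨z, hz, hzy⟩ := exists_lt_of_csInf_lt hne (lt_of_le_of_lt h hy)
      exact le_trans hz (hm hzy.le)
    have h2 : Tendsto F (𝓝[>] x) (𝓝 (F x)) := (hc x).mono_left (nhdsWithin_mono _ Ioi_subset_Ici_self)
    refine ge_of_tendsto h2 ?_
    filter_upwards [self_mem_nhdsWithin] with y hy using h1 y hy
  · intro h
    exact csInf_le hbdd h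

lemma aux_ge_one (F : ℝ → ℝ) (hF : IsDF F) (hF1 : F 1 = 0) (s : ℝ) (hs : 0 < s) (hs1 : s < 1) :
    1 ≤ genInv F (1 - s) := by
  by_contra h
  have h1 := (aux_galois F hF hF1 s hs hs1 1).1 (le_of_not_ge h)
  rw [hF1] at h1; linarith

lemma aux_log (F : ℝ → ℝ) (hF : IsDF F) (hF1 : F 1 = 0) (s : ℝ) (hs : 0 < s) (hs1 : s < 1) :
    genInv (fun x => F (Real.exp x)) (1 - s) = Real.log (genInv F (1 - s)) := by
  have h : {x | 1 - s ≤ F (Real.exp x)} = Ici (Real.log (genInv F (1 - s))) := by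
    ext x
    simp only [mem_ofPred_eq, mem_Ici]
    rw [← aux_galois F hF hF1 s hs hs1, Real.log_le_iff_le_exp]
    linarith [aux_ge_one F hF hF1 s hs hs1]
  unfold genInv at *
  simp only [] at *
  rw [h, csInf_Ici]

lemma aux_le_one (F : ℝ → ℝ) (hF : IsDF F) (x : ℝ) : F x ≤ 1 := by
  obtain ⟨hm, hc, -, ht⟩ := hF
  exact hm.ge_of_tendsto ht x

lemma aux_nonneg (F : ℝ → ℝ) (hF : IsDF F) (x : ℝ) : 0 ≤ F x := by
  obtain ⟨hm, hc, hb, ht⟩ := hF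
  exact hm.le_of_tendsto hb x

lemma aux_small (c d : ℝ) (hd : 0 < d) : ∀ᶠ u in 𝓝[>] (0:ℝ), c * u < d := by
  have h : Tendsto (fun u : ℝ => c * u) (𝓝[>] (0:ℝ)) (𝓝 (c * 0)) :=
    (tendsto_id.const_mul c).mono_left nhdsWithin_le_nhds
  rw [mul_zero] at h
  exact h.eventually (gt_mem_nhds hd)

lemma aux_pos : ∀ᶠ u in 𝓝[>] (0:ℝ), 0 < u := self_mem_nhdsWithin

lemma aux_mul (c : ℝ) (hc : 0 < c) : Tendsto (fun u : ℝ => c * u) (𝓝[>] (0:ℝ)) (𝓝[>] (0:ℝ)) := by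
  refine tendsto_nhdsWithin_iff.2 ⟨?_, ?_⟩
  · have h : Tendsto (fun u : ℝ => c * u) (𝓝[>] (0:ℝ)) (𝓝 (c * 0)) :=
      (tendsto_id.const_mul c).mono_left nhdsWithin_le_nhds
    rwa [mul_zero] at h
  · filter_upwards [aux_pos] with u hu using mul_pos hc hu

section core
variable (G V α : ℝ → ℝ) (hm : Monotone G) (h1 : ∀ x, G x ≤ 1)
  (hg : ∀ s x, 0 < s → s < 1 → (V s ≤ x ↔ 1 - s ≤ G x))
  (hα : ∀ᶠ u in 𝓝[>] (0:ℝ), 0 < α u)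
  (hV : ∀ c, 0 < c → Tendsto (fun u => (V (c * u) - V u) / α u) (𝓝[>] (0:ℝ)) (𝓝 (-Real.log c)))

include hg hα hV in
lemma core_pt (y : ℝ) : Tendsto (fun u => (1 - G (V u + α u * y)) / u) (𝓝[>] (0:ℝ))
    (𝓝 (Real.exp (-y))) := by
  have lower : ∀ c, 0 < c → c < Real.exp (-y) →
      ∀ᶠ u in 𝓝[>] (0:ℝ), c < (1 - G (V u + α u * y)) / u := by
    intro c hc hcy
    have : y < - Real.log c := by
      have := (Real.log_lt_iff_lt_exp hc).2 hcy
      linarith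
    filter_upwards [(hV c hc).eventually (lt_mem_nhds this), hα, aux_pos, aux_small c 1 one_pos]
      with u h2 h3 h4 h5
    rw [lt_div_iff₀ h3] at h2
    rw [lt_div_iff₀ h4]
    have := (hg (c * u) (V u + α u * y) (by positivity) h5).not.1 (by linarith)
    linarith
  rw [tendsto_order]
  constructor
  · intro c hcy
    have h := lower (max c (Real.exp (-y) / 2)) (lt_max_of_lt_right (by positivity))
      (max_lt hcy (by linarith [Real.exp_pos (-y)]))
    filter_upwards [h] with u hu using lt_of_le_of_lt (le_max_left _ _) hu
  · intro c' hcy'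
    obtain ⟨c, hcy, hcc⟩ := exists_between hcy'
    have hc : 0 < c := (Real.exp_pos _).trans hcy
    have : - Real.log c < y := by
      have := (Real.lt_log_iff_exp_lt hc).2 hcy
      linarith
    filter_upwards [(hV c hc).eventually (gt_mem_nhds this), hα, aux_pos, aux_small c 1 one_pos]
      with u h2 h3 h4 h5
    rw [div_lt_iff₀ h3] at h2
    refine lt_of_le_of_lt ?_ hcc
    rw [div_le_iff₀ h4]
    have := (hg (c * u) (V u + α u * y) (by positivity) h5).1 (by linarith)
    linarith

include hα hV in
lemma core_ratio : Tendsto (fun u => α (4⁻¹ * u) / α u) (𝓝[>] (0:ℝ)) (𝓝 1) := by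
  have hL : Real.log 4⁻¹ ≠ 0 := by
    rw [Real.log_inv]
    have := Real.log_pos (show (1:ℝ) < 4 by norm_num)
    linarith
  have A := (hV 4⁻¹ (by norm_num)).comp (aux_mul 4⁻¹ (by norm_num))
  have B := (hV (4⁻¹ * 4⁻¹) (by norm_num)).sub (hV 4⁻¹ (by norm_num))
  have C := B.div A (by simpa using hL)
  have e : (-Real.log (4⁻¹ * 4⁻¹) - -Real.log 4⁻¹) / -Real.log 4⁻¹ = (1:ℝ) := by
    rw [Real.log_mul (by norm_num) (by norm_num)]
    field_simp
    ring
  rw [e] at C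
  refine C.congr' ?_
  have D := A.eventually_ne (show -Real.log 4⁻¹ ≠ 0 by simpa using hL)
  filter_upwards [hα, (aux_mul 4⁻¹ (by norm_num)).eventually hα, D] with u h2 h3 h4
  simp only [Function.comp, Pi.div_apply, ← mul_assoc] at *
  have h5 : V (4⁻¹ * 4⁻¹ * u) - V (4⁻¹ * u) ≠ 0 := by
    intro h; rw [h] at h4; simp at h4
  generalize V (4⁻¹ * 4⁻¹ * u) = p at *
  generalize V (4⁻¹ * u) = q at *
  generalize α (4⁻¹ * u) = w at *
  field_simp
  ring

include hg hα hV in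
lemma core_dom : ∀ᶠ u in 𝓝[>] (0:ℝ), ∀ y, 0 ≤ y →
    (1 - G (V u + α u * y)) / u ≤ 16 * (1 + y ^ 2)⁻¹ := by
  have hl4 : - Real.log 4⁻¹ < 2 := by
    rw [Real.log_inv, neg_neg, show (4:ℝ) = 2 ^ 2 by norm_num, Real.log_pow]
    have := Real.log_two_lt_d9
    push_cast; linarith
  have E : ∀ᶠ u in 𝓝[>] (0:ℝ), 0 < α u ∧ V (4⁻¹ * u) - V u ≤ 2 * α u ∧ α (4⁻¹ * u) ≤ 2 * α u := by
    filter_upwards [hα, (hV 4⁻¹ (by norm_num)).eventually (gt_mem_nhds hl4),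
      (core_ratio V α hα hV).eventually (gt_mem_nhds (show (1:ℝ) < 2 by norm_num))] with u h2 h3 h4
    rw [div_lt_iff₀ h2] at h3 h4
    exact ⟨h2, h3.le, h4.le⟩
  obtain ⟨u0, hu0, H⟩ := (mem_nhdsGT_iff_exists_Ioo_subset).1 E
  filter_upwards [aux_pos, aux_small 1 u0 hu0, aux_small 1 1 one_pos] with u hu hu' hu1
  rw [one_mul] at hu' hu1
  have key : ∀ k : ℕ, α ((4⁻¹)^k * u) ≤ 2 ^ k * α u ∧
      V ((4⁻¹)^k * u) ≤ V u + 2 * α u * (2 ^ k - 1) := by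
    intro k
    induction k with
    | zero => simp
    | succ k ih =>
      have hp : (4⁻¹ : ℝ)^k ≤ 1 := pow_le_one₀ (by norm_num) (by norm_num)
      have hk := H (show (4⁻¹ : ℝ)^k * u ∈ Ioo 0 u0 from
        ⟨by positivity, by nlinarith⟩)
      obtain ⟨h2, h3, h4⟩ := hk
      have e : (4⁻¹ : ℝ)^(k+1) * u = 4⁻¹ * ((4⁻¹)^k * u) := by ring
      rw [e, pow_succ]
      constructor <;> nlinarith
  intro y hy
  obtain ⟨k, hk1, hk2⟩ := exists_nat_pow_near (show (1:ℝ) ≤ 1 + y / 2 by linarith)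
    (show (1:ℝ) < 2 by norm_num)
  have hαu := (H (show u ∈ Ioo 0 u0 from ⟨hu, hu'⟩)).1
  have hp : (4⁻¹ : ℝ)^k ≤ 1 := pow_le_one₀ (by norm_num) (by norm_num)
  have h2 : V ((4⁻¹)^k * u) ≤ V u + α u * y := by
    have := (key k).2
    nlinarith
  have h3 := (hg ((4⁻¹)^k * u) _ (by positivity) (by nlinarith)).1 h2
  rw [div_le_iff₀ hu]
  have h4 : (4⁻¹ : ℝ)^k ≤ 16 * (1 + y^2)⁻¹ := by
    rw [← div_eq_mul_inv, le_div_iff₀ (by positivity), inv_pow, inv_mul_le_iff₀ (by positivity)]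
    have : (4:ℝ)^k = (2^k)^2 := by rw [← pow_mul, mul_comm, pow_mul]; norm_num
    rw [this]
    rw [pow_succ] at hk2
    nlinarith [pow_pos (show (0:ℝ) < 2 by norm_num) k]
  nlinarith

include hm h1 hg hα hV in
lemma core_R : Tendsto (fun u => RpInf 1 (V u) G / α u) (𝓝[>] (0:ℝ)) (𝓝 1) := by
  have I : Tendsto (fun u => ∫ y in Ioi (0:ℝ), (1 - G (V u + α u * y)) / u) (𝓝[>] (0:ℝ))
      (𝓝 (∫ y in Ioi (0:ℝ), Real.exp (-y))) := by
    refine tendsto_integral_filter_of_dominated_convergence (fun y => 16 * (1 + y ^ 2)⁻¹) ?_ ?_ ?_ ?_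
    · refine Eventually.of_forall fun u => ?_
      have : Measurable G := hm.measurable
      exact Measurable.aestronglyMeasurable (by fun_prop)
    · filter_upwards [core_dom G V α hg hα hV, aux_pos] with u hu hu0
      refine (ae_restrict_iff' measurableSet_Ioi).2 (Eventually.of_forall fun y hy => ?_)
      rw [Real.norm_eq_abs, abs_of_nonneg]
      · exact hu y (le_of_lt hy)
      · exact div_nonneg (by linarith [h1 (V u + α u * y)]) hu0.le
    · exact (integrable_inv_one_add_sq.const_mul 16).integrableOn
    · exact Eventually.of_forall fun y => core_pt G V α hg hα hV y
  rw [integral_exp_neg_Ioi_zero] at I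
  have P := core_pt G V α hg hα hV 0
  rw [neg_zero, Real.exp_zero] at P
  have Q := I.div P one_ne_zero
  rw [div_one] at Q
  refine Q.congr' ?_
  filter_upwards [hα, aux_pos] with u h2 h3
  have e : ∫ y in Ioi (0:ℝ), (1 - G (V u + α u * y)) / u
      = u⁻¹ * (α u)⁻¹ * ∫ t in Ioi (V u), (1 - G t) := by
    simp_rw [div_eq_inv_mul]
    rw [integral_const_mul, mul_assoc]
    congr 1
    have := integral_comp_mul_left_Ioi (fun z => 1 - G (V u + z)) 0 h2
    rw [this, mul_zero, smul_eq_mul]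
    congr 1
    have h := (measurePreserving_add_left volume (V u)).setIntegral_preimage_emb
      (measurableEmbedding_addLeft (V u)) (fun t => 1 - G t) (Ioi (V u))
    simpa using h
  simp only [Pi.div_apply, RpInf, iterIntInf, mul_zero, add_zero, Nat.sub_self]
  rw [e]
  field_simp

include hm h1 hg hα hV in
lemma core_main (l : ℝ) (hl : 0 < l) :
    Tendsto (fun u => (V (l * u) - V u) / RpInf 1 (V u) G) (𝓝[>] (0:ℝ)) (𝓝 (-Real.log l)) := by
  have := (hV l hl).div (core_R G V α hm h1 hg hα hV) one_ne_zero
  rw [div_one] at this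
  refine this.congr' ?_
  filter_upwards [hα] with u h2
  simp only [Pi.div_apply]
  rw [div_div_div_cancel_right₀ h2.ne']

end core

lemma seqA (F : ℝ → ℝ) (hF : IsDF F) (hF1 : F 1 = 0) (M : ℝ → ℝ) (a b : ℕ → ℝ)
    (ha : ∀ n, 0 < a n)
    (hM : ∀ x, Tendsto (fun n => F (a n * x + b n) ^ n) atTop (𝓝 (M x)))
    (c h : ℝ) (hlo : ∀ x, x < h → M x < Real.exp (-c)) (hhi : ∀ x, h < x → Real.exp (-c) < M x)
    (r : ℕ → ℝ) (hr : Tendsto (fun n : ℕ => (n : ℝ) * r n) atTop (𝓝 c))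
    (hr1 : ∀ᶠ n in atTop, 0 < r n ∧ r n < 1) :
    Tendsto (fun n => (genInv F (1 - r n) - b n) / a n) atTop (𝓝 h) := by
  have hE : Tendsto (fun n : ℕ => (1 - r n) ^ n) atTop (𝓝 (Real.exp (-c))) := by
    have := Real.tendsto_one_add_pow_exp_of_tendsto (g := fun n => - r n) (t := -c) (by
      simpa using hr.neg)
    simpa [sub_eq_add_neg] using this
  rw [tendsto_order]
  constructor
  · intro x hx
    filter_upwards [(hM x).eventually_lt hE (hlo x hx), hr1] with n h1 h2
    have h3 := lt_of_pow_lt_pow_left₀ n (by linarith) h1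
    have := (aux_galois F hF hF1 (r n) h2.1 h2.2 (a n * x + b n)).not.2 (by linarith)
    rw [lt_div_iff₀ (ha n)]
    linarith
  · intro x' hx'
    obtain ⟨x, hx, hxx⟩ := exists_between hx'
    filter_upwards [hE.eventually_lt (hM x) (hhi x hx), hr1] with n h1 h2
    have h3 := lt_of_pow_lt_pow_left₀ n (aux_nonneg F hF _) h1
    have := (aux_galois F hF hF1 (r n) h2.1 h2.2 (a n * x + b n)).2 h3.le
    refine lt_of_le_of_lt ?_ hxx
    rw [div_le_iff₀ (ha n)]
    linarith

lemma aux_anti (F : ℝ → ℝ) (hF : IsDF F) (hF1 : F 1 = 0) (s t : ℝ) (hs : 0 < s) (hst : s ≤ t)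
    (ht : t < 1) : genInv F (1 - t) ≤ genInv F (1 - s) := by
  rw [aux_galois F hF hF1 t (by linarith) ht]
  have := (aux_galois F hF hF1 s hs (by linarith) (genInv F (1 - s))).1 le_rfl
  linarith

lemma aux_floor : Tendsto (fun u : ℝ => ⌊u⁻¹⌋₊) (𝓝[>] (0:ℝ)) atTop :=
  tendsto_nat_floor_atTop.comp tendsto_inv_nhdsGT_zero

lemma contA (F : ℝ → ℝ) (hF : IsDF F) (hF1 : F 1 = 0) (M : ℝ → ℝ) (a b : ℕ → ℝ)
    (ha : ∀ n, 0 < a n)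
    (hM : ∀ x, Tendsto (fun n => F (a n * x + b n) ^ n) atTop (𝓝 (M x)))
    (c h : ℝ) (hc : 0 < c)
    (hlo : ∀ x, x < h → M x < Real.exp (-c)) (hhi : ∀ x, h < x → Real.exp (-c) < M x) :
    Tendsto (fun u => (genInv F (1 - c * u) - b ⌊u⁻¹⌋₊) / a ⌊u⁻¹⌋₊) (𝓝[>] (0:ℝ)) (𝓝 h) := by
  have t1 : Tendsto (fun n : ℕ => c / (n : ℝ)) atTop (𝓝 0) := tendsto_const_div_atTop_nhds_zero_nat c
  have t2 : Tendsto (fun n : ℕ => c / ((n : ℝ) + 1)) atTop (𝓝 0) := by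
    have := (tendsto_add_atTop_iff_nat 1).2 t1
    simpa using this
  have e1 : ∀ᶠ n : ℕ in atTop, 0 < c / (n:ℝ) ∧ c / (n:ℝ) < 1 := by
    filter_upwards [t1.eventually (gt_mem_nhds one_pos), eventually_gt_atTop 0] with n h1 h2
    exact ⟨by positivity, h1⟩
  have e2 : ∀ᶠ n : ℕ in atTop, 0 < c / ((n:ℝ) + 1) ∧ c / ((n:ℝ) + 1) < 1 := by
    filter_upwards [t2.eventually (gt_mem_nhds one_pos)] with n h1
    exact ⟨by positivity, h1⟩
  have s1 := seqA F hF hF1 M a b ha hM c h hlo hhi (fun n => c / (n:ℝ)) (by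
    refine tendsto_const_nhds.congr' ?_
    filter_upwards [eventually_gt_atTop 0] with n h2
    field_simp) e1
  have s2 := seqA F hF hF1 M a b ha hM c h hlo hhi (fun n => c / ((n:ℝ) + 1)) (by
    have : Tendsto (fun n : ℕ => c - c / ((n:ℝ) + 1)) atTop (𝓝 (c - 0)) := t2.const_sub c
    rw [sub_zero] at this
    refine this.congr fun n => ?_
    field_simp
    ring) e2
  refine tendsto_of_tendsto_of_tendsto_of_le_of_le' (s1.comp aux_floor) (s2.comp aux_floor) ?_ ?_
  · filter_upwards [aux_pos, aux_floor.eventually e1, aux_floor.eventually (eventually_gt_atTop 0)]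
      with u h1 h2 h3
    simp only [Function.comp]
    have hf : (⌊u⁻¹⌋₊ : ℝ) ≤ u⁻¹ := Nat.floor_le (by positivity)
    have h3' : (0:ℝ) < ⌊u⁻¹⌋₊ := by exact_mod_cast h3
    have hu : c * u ≤ c / (⌊u⁻¹⌋₊ : ℝ) := by
      rw [div_eq_mul_inv]
      gcongr
      rwa [le_inv_comm₀ h1 h3']
    have := aux_anti F hF hF1 _ _ (by positivity) hu h2.2
    have := ha ⌊u⁻¹⌋₊
    gcongr
  · filter_upwards [aux_pos, aux_small c 1 one_pos] with u h1 h2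
    simp only [Function.comp]
    have hf : u⁻¹ < (⌊u⁻¹⌋₊ : ℝ) + 1 := Nat.lt_floor_add_one _
    have hu : c / ((⌊u⁻¹⌋₊ : ℝ) + 1) ≤ c * u := by
      rw [div_eq_mul_inv]
      gcongr
      rw [inv_le_comm₀ (by positivity) h1]
      exact hf.le
    have := aux_anti F hF hF1 _ _ (by positivity) hu h2
    have := ha ⌊u⁻¹⌋₊
    gcongr

lemma gumbelV (F : ℝ → ℝ) (hF : IsDF F) (hF1 : F 1 = 0) (hd : MemDomAttr F gumbelDF) :
    ∃ α : ℝ → ℝ, (∀ᶠ u in 𝓝[>] (0:ℝ), 0 < α u) ∧ ∀ c, 0 < c →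
      Tendsto (fun u => (Real.log (genInv F (1 - c * u)) - Real.log (genInv F (1 - u))) / α u)
        (𝓝[>] (0:ℝ)) (𝓝 (-Real.log c)) := by
  obtain ⟨a, b, ha, hM⟩ := hd
  have hcont : Continuous gumbelDF := by unfold gumbelDF; fun_prop
  have hM' := fun x => hM x hcont.continuousAt
  set A : ℝ → ℝ := fun u => a ⌊u⁻¹⌋₊ with hA
  set Q : ℝ → ℝ := fun u => genInv F (1 - u) with hQ
  have hApos : ∀ u, 0 < A u := fun u => ha _
  have hQpos : ∀ c, 0 < c → ∀ᶠ u in 𝓝[>] (0:ℝ), 1 ≤ Q (c * u) := by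
    intro c hc
    filter_upwards [aux_pos, aux_small c 1 one_pos] with u h1 h2
    exact aux_ge_one F hF hF1 _ (by positivity) h2
  have hQpos1 : ∀ᶠ u in 𝓝[>] (0:ℝ), 1 ≤ Q u := by simpa using hQpos 1 one_pos
  have base : ∀ c, 0 < c → Tendsto (fun u => (Q (c * u) - b ⌊u⁻¹⌋₊) / A u) (𝓝[>] (0:ℝ))
      (𝓝 (-Real.log c)) := by
    intro c hc
    refine contA F hF hF1 gumbelDF a b ha hM' c _ hc ?_ ?_
    · intro x hx
      unfold gumbelDF
      rw [Real.exp_lt_exp, neg_lt_neg_iff, ← Real.log_lt_iff_lt_exp hc]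
      linarith
    · intro x hx
      unfold gumbelDF
      rw [Real.exp_lt_exp, neg_lt_neg_iff, ← Real.lt_log_iff_exp_lt hc]
      linarith
  have diff : ∀ c, 0 < c → Tendsto (fun u => (Q (c * u) - Q u) / A u) (𝓝[>] (0:ℝ))
      (𝓝 (-Real.log c)) := by
    intro c hc
    have := (base c hc).sub (base 1 one_pos)
    simp only [Real.log_one, neg_zero, sub_zero, one_mul] at this
    refine this.congr fun u => ?_
    rw [← sub_div]; congr 1; ring
  have hinf : Tendsto (fun u => Q u / A u) (𝓝[>] (0:ℝ)) atTop := by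
    rw [tendsto_atTop]
    intro K
    have h := diff (Real.exp (K + 1)) (Real.exp_pos _)
    rw [Real.log_exp] at h
    filter_upwards [h.eventually (gt_mem_nhds (show -(K+1) < -K by linarith)),
      hQpos _ (Real.exp_pos (K+1))] with u h1 h2
    rw [div_lt_iff₀ (hApos u)] at h1
    rw [le_div_iff₀ (hApos u)]
    nlinarith
  have h0 : Tendsto (fun u => A u / Q u) (𝓝[>] (0:ℝ)) (𝓝 0) := by
    have := hinf.inv_tendsto_atTop
    refine this.congr fun u => ?_
    simp
  refine ⟨fun u => A u / Q u, ?_, ?_⟩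
  · filter_upwards [hQpos1] with u h1
    exact div_pos (hApos u) (by linarith)
  · intro c hc
    have d := diff c hc
    have y : Tendsto (fun u => Q (c * u) / Q u) (𝓝[>] (0:ℝ)) (𝓝 1) := by
      have := (d.mul h0).const_add 1
      rw [mul_zero, add_zero] at this
      refine this.congr' ?_
      filter_upwards [hQpos1] with u h1
      have := hApos u
      have : 0 < Q u := by linarith
      field_simp
      ring
    have d2 := d.div y one_ne_zero
    rw [div_one] at d2
    refine tendsto_of_tendsto_of_tendsto_of_le_of_le' d2 d ?_ ?_
    · filter_upwards [hQpos1, hQpos c hc] with u h1 h2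
      have hA := hApos u
      have p1 : 0 < Q u := by linarith
      have p2 : 0 < Q (c * u) := by linarith
      change _ ≤ (Real.log (Q (c * u)) - Real.log (Q u)) / (A u / Q u)
      rw [← Real.log_div p2.ne' p1.ne', le_div_iff₀ (by positivity)]
      have := Real.one_sub_inv_le_log_of_pos (div_pos p2 p1)
      refine le_trans (le_of_eq ?_) this
      simp only [Pi.div_apply]
      field_simp
    · filter_upwards [hQpos1, hQpos c hc] with u h1 h2
      have hA := hApos u
      have p1 : 0 < Q u := by linarith
      have p2 : 0 < Q (c * u) := by linarith
      change (Real.log (Q (c * u)) - Real.log (Q u)) / (A u / Q u) ≤ _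
      rw [← Real.log_div p2.ne' p1.ne', div_le_iff₀ (by positivity)]
      have := Real.log_le_sub_one_of_pos (div_pos p2 p1)
      refine le_trans this (le_of_eq ?_)
      field_simp

lemma recur (e : ℕ → ℝ) (s δ : ℝ → ℝ) (σ : ℝ) (hσ0 : 0 ≤ σ) (hσ : σ < 1)
    (hs : Tendsto s (𝓝[>] (0:ℝ)) (𝓝 σ)) (hδ : Tendsto δ (𝓝[>] (0:ℝ)) (𝓝 0))
    (he : ∀ u, 0 < u → e ⌊(2⁻¹ * u)⁻¹⌋₊ = e ⌊u⁻¹⌋₊ * s u + δ u) :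
    Tendsto (fun u : ℝ => e ⌊u⁻¹⌋₊) (𝓝[>] (0:ℝ)) (𝓝 0) := by
  rw [Metric.tendsto_nhds]
  intro ε hε
  obtain ⟨τ, hτ, hτ1⟩ := exists_between hσ
  have hτ0 : 0 < τ := by linarith
  have E : ∀ᶠ u in 𝓝[>] (0:ℝ), |s u| < τ ∧ |δ u| < ε / 2 * (1 - τ) := by
    have h1 := hs.abs
    rw [abs_of_nonneg hσ0] at h1
    have h2 := hδ.abs
    rw [abs_zero] at h2
    have : 0 < 1 - τ := by linarith
    exact (h1.eventually (gt_mem_nhds hτ)).and (h2.eventually (gt_mem_nhds (by positivity)))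
  obtain ⟨u0, hu0, H⟩ := (mem_nhdsGT_iff_exists_Ioo_subset).1 E
  have hu0 : 0 < u0 := hu0
  -- bound on a fundamental interval
  obtain ⟨K, hK⟩ : ∃ K : ℝ, ∀ n ∈ Finset.range (⌊(u0/4)⁻¹⌋₊ + 1), |e n| ≤ K := by
    obtain ⟨K, hK⟩ := ((Finset.range (⌊(u0/4)⁻¹⌋₊ + 1)).image (fun n => |e n|)).bddAbove
    exact ⟨K, fun n hn => hK (by simpa using ⟨n, by simpa using hn, rfl⟩)⟩
  have hK0 : 0 ≤ K := le_trans (abs_nonneg _) (hK 0 (by simp))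
  have hKv : ∀ v, u0 / 4 ≤ v → |e ⌊v⁻¹⌋₊| ≤ K := by
    intro v hv
    refine hK _ ?_
    rw [Finset.mem_range, Nat.lt_succ_iff]
    exact Nat.floor_mono (by gcongr)
  have step : ∀ k : ℕ, ∀ v, u0 / 4 ≤ v → v < u0 → |e ⌊((2⁻¹)^k * v)⁻¹⌋₊| ≤ ε / 2 + τ ^ k * K := by
    intro k v hv hv1
    have hv0 : 0 < v := by linarith
    induction k with
    | zero => simpa using by linarith [hKv v hv]
    | succ k ih =>
      have hp : (2⁻¹ : ℝ)^k ≤ 1 := pow_le_one₀ (by norm_num) (by norm_num)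
      obtain ⟨h1, h2⟩ := H (show (2⁻¹ : ℝ)^k * v ∈ Ioo 0 u0 from ⟨by positivity, by nlinarith⟩)
      have q : (2⁻¹ : ℝ)^(k+1) * v = 2⁻¹ * ((2⁻¹)^k * v) := by ring
      rw [q, he _ (by positivity)]
      calc |e ⌊((2⁻¹)^k * v)⁻¹⌋₊ * s ((2⁻¹)^k * v) + δ ((2⁻¹)^k * v)|
          ≤ |e ⌊((2⁻¹)^k * v)⁻¹⌋₊| * |s ((2⁻¹)^k * v)| + |δ ((2⁻¹)^k * v)| := by
            rw [← abs_mul]; exact abs_add_le _ _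
        _ ≤ (ε / 2 + τ ^ k * K) * τ + ε / 2 * (1 - τ) := by gcongr
        _ = ε / 2 + τ ^ (k+1) * K := by ring
  have hk : ∀ᶠ k : ℕ in atTop, τ ^ k * K < ε / 2 := by
    have := (tendsto_pow_atTop_nhds_zero_of_lt_one hτ0.le hτ1).mul_const K
    rw [zero_mul] at this
    exact this.eventually (gt_mem_nhds (by positivity))
  obtain ⟨k0, hk0⟩ := eventually_atTop.1 hk
  have hsm := aux_small 1 (u0 * (2⁻¹)^(k0+1)) (by positivity)
  filter_upwards [aux_pos, hsm] with u hu hu1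
  rw [one_mul] at hu1
  have hpp : (2⁻¹ : ℝ)^(k0+1) ≤ 1 := pow_le_one₀ (by norm_num) (by norm_num)
  obtain ⟨k, hk1, hk2⟩ := exists_nat_pow_near (show (1:ℝ) ≤ (u0 / 2) / u by
    rw [le_div_iff₀ hu]
    have : (2⁻¹ : ℝ)^k0 ≤ 1 := pow_le_one₀ (by norm_num) (by norm_num)
    rw [pow_succ] at hu1
    nlinarith)
    (show (1:ℝ) < 2 by norm_num)
  rw [le_div_iff₀ hu] at hk1
  rw [div_lt_iff₀ hu] at hk2
  have hkk : k0 ≤ k := by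
    by_contra hlt
    have h3 : (2:ℝ)^(k+1) ≤ 2^k0 := pow_le_pow_right₀ (by norm_num) (by omega)
    have h4 : u * 2^k0 < u0 / 2 := by
      have : u * 2^k0 < u0 * (2⁻¹)^(k0+1) * 2^k0 := by gcongr
      refine lt_of_lt_of_eq this ?_
      rw [pow_succ, inv_pow]; field_simp
    nlinarith
  have h5 := step k (2^k * u) (by rw [pow_succ] at hk2; linarith) (by linarith)
  have h6 : (2⁻¹ : ℝ)^k * (2^k * u) = u := by rw [inv_pow]; field_simp
  rw [h6] at h5
  rw [Real.dist_eq, sub_zero]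
  linarith [hk0 k hkk]

lemma frechetV (F : ℝ → ℝ) (hF : IsDF F) (hF1 : F 1 = 0) (hd : MemFrechetDom F) :
    ∃ α : ℝ → ℝ, (∀ᶠ u in 𝓝[>] (0:ℝ), 0 < α u) ∧ ∀ c, 0 < c →
      Tendsto (fun u => (Real.log (genInv F (1 - c * u)) - Real.log (genInv F (1 - u))) / α u)
        (𝓝[>] (0:ℝ)) (𝓝 (-Real.log c)) := by
  obtain ⟨γ, hγ, a, b, ha, hM⟩ := hd
  set A : ℝ → ℝ := fun u => a ⌊u⁻¹⌋₊ with hA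
  set B : ℝ → ℝ := fun u => b ⌊u⁻¹⌋₊ with hB
  set Q : ℝ → ℝ := fun u => genInv F (1 - u) with hQ
  have hApos : ∀ u, 0 < A u := fun u => ha _
  have hQpos : ∀ c, 0 < c → ∀ᶠ u in 𝓝[>] (0:ℝ), 1 ≤ Q (c * u) := by
    intro c hc
    filter_upwards [aux_pos, aux_small c 1 one_pos] with u h1 h2
    exact aux_ge_one F hF hF1 _ (by positivity) h2
  have hcont : ∀ x, ContinuousAt (frechetDF γ) x := by
    intro x
    rcases lt_trichotomy x 0 with hx | hx | hx
    · have : (fun _ => (0:ℝ)) =ᶠ[𝓝 x] frechetDF γ := by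
        filter_upwards [gt_mem_nhds hx] with y hy
        simp [frechetDF, hy.le.not_gt]
      exact continuousAt_const.congr this
    · subst hx
      have h0 : frechetDF γ 0 = 0 := by simp [frechetDF]
      rw [continuousAt_iff_continuous_left'_right']
      unfold ContinuousWithinAt
      rw [h0]
      constructor
      · refine tendsto_const_nhds.congr' ?_
        filter_upwards [self_mem_nhdsWithin] with y hy
        have hy : y < 0 := hy
        simp [frechetDF, hy.le.not_gt]
      · have h1 : Tendsto (fun y : ℝ => y ^ (-γ)) (𝓝[>] 0) atTop :=
          tendsto_rpow_neg_nhdsGT_zero (by linarith)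
        have h2 : Tendsto (fun y : ℝ => Real.exp (-(y ^ (-γ)))) (𝓝[>] 0) (𝓝 0) :=
          Real.tendsto_exp_neg_atTop_nhds_zero.comp h1
        refine h2.congr' ?_
        filter_upwards [self_mem_nhdsWithin] with y hy
        have hy : 0 < y := hy
        simp [frechetDF, hy]
    · have : (fun y => Real.exp (-(y ^ (-γ)))) =ᶠ[𝓝 x] frechetDF γ := by
        filter_upwards [lt_mem_nhds hx] with y hy
        simp [frechetDF, hy]
      refine ContinuousAt.congr ?_ this
      have := Real.continuousAt_rpow_const x (-γ) (Or.inl hx.ne')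
      exact this.neg.rexp
  have hM' := fun x => hM x (hcont x)
  set ρ : ℝ := γ⁻¹ with hρ
  have hρ0 : 0 < ρ := by positivity
  have base : ∀ c, 0 < c → Tendsto (fun u => (Q (c * u) - B u) / A u) (𝓝[>] (0:ℝ))
      (𝓝 (c ^ (-ρ))) := by
    intro c hc
    have hcc : (c ^ (-ρ)) ^ (-γ) = c := by
      rw [← Real.rpow_mul hc.le, hρ, neg_mul_neg, inv_mul_cancel₀ hγ.ne', Real.rpow_one]
    have hcp : 0 < c ^ (-ρ) := Real.rpow_pos_of_pos hc _
    refine contA F hF hF1 (frechetDF γ) a b ha hM' c _ hc ?_ ?_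
    · intro x hx
      unfold frechetDF
      split_ifs with h0
      · rw [Real.exp_lt_exp, neg_lt_neg_iff]
        have := Real.rpow_lt_rpow_of_neg h0 hx (show -γ < 0 by linarith)
        rwa [hcc] at this
      · exact Real.exp_pos _
    · intro x hx
      unfold frechetDF
      rw [if_pos (hcp.trans hx), Real.exp_lt_exp, neg_lt_neg_iff]
      have := Real.rpow_lt_rpow_of_neg hcp hx (show -γ < 0 by linarith)
      rwa [hcc] at this
  have half := aux_mul (2⁻¹) (by norm_num)
  set κ : ℝ := (2:ℝ)⁻¹ ^ (-ρ) with hκ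
  have hκ1 : 1 < κ := by
    rw [hκ]
    exact Real.one_lt_rpow_of_pos_of_lt_one_of_neg (by norm_num) (by norm_num) (by linarith)
  have hκ2 : (2:ℝ) ^ (-ρ) = κ⁻¹ := by
    rw [hκ, Real.inv_rpow (by norm_num), inv_inv]
  have B1 := base 1 one_pos
  have Bh := base 2⁻¹ (by norm_num)
  have C1 := B1.comp half
  have C2 := (base 2 (by norm_num)).comp half
  rw [← hκ] at Bh
  rw [Real.one_rpow] at B1 C1
  rw [hκ2] at C2
  simp only [Function.comp_def, one_mul, ← mul_assoc] at B1 C1 C2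
  rw [show (2:ℝ) * 2⁻¹ = 1 by norm_num] at C2
  simp only [one_mul] at C2
  have hκi : κ⁻¹ < 1 := inv_lt_one_of_one_lt₀ hκ1
  have D1 := (C1.sub C2)
  have D2 := (Bh.sub B1)
  have S := D1.div D2 (by linarith)
  have hS : (1 - κ⁻¹) / (κ - 1) = κ⁻¹ := by
    have : κ - 1 ≠ 0 := by linarith
    have : κ ≠ 0 := by linarith
    field_simp
  rw [hS] at S
  have S' : Tendsto (fun u => A u / A (2⁻¹ * u)) (𝓝[>] (0:ℝ)) (𝓝 κ⁻¹) := by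
    refine S.congr' ?_
    filter_upwards [D2.eventually_ne (show κ - 1 ≠ 0 by linarith)] with u h1
    simp only [Pi.div_apply]
    have p1 := hApos u
    have p2 := hApos (2⁻¹ * u)
    rw [← sub_div, ← sub_div]
    rw [← sub_div] at h1
    rw [show Q (2⁻¹ * u) - B u - (Q u - B u) = Q (2⁻¹ * u) - Q u by ring] at *
    rw [show Q (2⁻¹ * u) - B (2⁻¹ * u) - (Q u - B (2⁻¹ * u)) = Q (2⁻¹ * u) - Q u by ring] at *
    have h5 : Q (2⁻¹ * u) - Q u ≠ 0 := by
      intro h; rw [h] at h1; simp at h1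
    generalize Q (2⁻¹ * u) - Q u = w at *
    field_simp
  have Dl : Tendsto (fun u => (B (2⁻¹ * u) - B u) / A (2⁻¹ * u)) (𝓝[>] (0:ℝ)) (𝓝 0) := by
    have h := (Bh.mul S').sub C1
    rw [mul_inv_cancel₀ (by linarith), sub_self] at h
    refine h.congr fun u => ?_
    have p1 := hApos u
    have p2 := hApos (2⁻¹ * u)
    field_simp
    ring
  have e0 : Tendsto (fun u => B u / A u) (𝓝[>] (0:ℝ)) (𝓝 0) := by
    refine recur (fun n => b n / a n) _ _ κ⁻¹ (by positivity) hκi S' Dl ?_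
    intro u hu
    change B (2⁻¹ * u) / A (2⁻¹ * u) = B u / A u * _ + _
    have p1 := hApos u
    have p2 := hApos (2⁻¹ * u)
    field_simp
    ring
  have QA : ∀ c, 0 < c → Tendsto (fun u => Q (c * u) / A u) (𝓝[>] (0:ℝ)) (𝓝 (c ^ (-ρ))) := by
    intro c hc
    have h := (base c hc).add e0
    rw [add_zero] at h
    refine h.congr fun u => ?_
    rw [← add_div]; congr 1; ring
  refine ⟨fun _ => ρ, Eventually.of_forall fun _ => hρ0, ?_⟩
  intro c hc
  have LA : ∀ c, 0 < c → Tendsto (fun u => Real.log (Q (c * u)) - Real.log (A u)) (𝓝[>] (0:ℝ))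
      (𝓝 (-ρ * Real.log c)) := by
    intro c hc
    have h := (QA c hc).log (Real.rpow_pos_of_pos hc _).ne'
    rw [Real.log_rpow hc] at h
    refine h.congr' ?_
    filter_upwards [hQpos c hc] with u h1
    rw [Real.log_div (by linarith) (hApos u).ne']
  have h := ((LA c hc).sub (LA 1 one_pos)).div_const ρ
  have hv : (-ρ * Real.log c - -ρ * Real.log 1) / ρ = - Real.log c := by
    rw [Real.log_one]; field_simp; ring
  rw [hv] at h
  refine h.congr fun u => ?_
  change _ = (Real.log (Q (c * u)) - Real.log (Q u)) / ρ
  rw [one_mul]; congr 1; ring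

/-- Formula (3.13). -/
theorem genInv_diff_div_R1_tendsto_neg_log (F : ℝ → ℝ) (hF : IsDF F) (hF1 : F 1 = 0)
    (hdom : MemFrechetDom F ∨ MemDomAttr F gumbelDF)
    (G : ℝ → ℝ) (hG : G = fun x => F (Real.exp x)) (l : ℝ) (hl : 0 < l) :
    Tendsto
      (fun u => (genInv G (1 - l * u) - genInv G (1 - u)) / RpInf 1 (genInv G (1 - u)) G)
      (𝓝[>] (0 : ℝ)) (𝓝 (-Real.log l)) := by
  obtain ⟨α, hα, hV⟩ := hdom.elim (frechetV F hF hF1) (gumbelV F hF hF1)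
  subst hG
  refine core_main (fun x => F (Real.exp x)) (fun s => genInv (fun x => F (Real.exp x)) (1 - s)) α
    (fun x y h => hF.1 (Real.exp_le_exp.2 h)) (fun x => aux_le_one F hF _) ?_ hα ?_ l hl
  · intro s x hs hs1
    rw [aux_log F hF hF1 s hs hs1, Real.log_le_iff_le_exp
      (by linarith [aux_ge_one F hF hF1 s hs hs1]), aux_galois F hF hF1 s hs hs1]
  · intro c hc
    refine (hV c hc).congr' ?_
    filter_upwards [aux_pos, aux_small c 1 one_pos, aux_small 1 1 one_pos] with u h1 h2 h3
    rw [one_mul] at h3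
    rw [aux_log F hF hF1 _ h1 h3, aux_log F hF hF1 _ (by positivity) h2]

end
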